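/- Let r > 0, ρ > 0, k ∈ (0,1), and let γ > 1 satisfy γ² − γ − 2r/ρ² = 0. Set c := kγ/(k+γ−1), G(π) := (1−π)(π/(1−π))^γ, and define v̂ : (0,1) → ℝ by v̂(π) := ((c−k)/G(c))·G(π) for π < c and v̂(π) := π − k for π ≥ c. Then: (i) v̂ is continuously differentiable on (0,1) (value match and smooth fit hold at π = c); (ii) v̂ is convex on (0,1); (iii) v̂(π) ≥ π − k for all π ∈ (0,1); and (iv) (ρ²/2)π²(1−π)²·v̂''(π) − r·v̂(π) ≤ 0 for every π ∈ (0,1) with π ≠ c. -/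

import Mathlib

open Set

/-- Derivative of the homogeneous solution `x ↦ (1 - x) * (x / (1 - x)) ^ γ`. -/
theorem hasDerivAt_one_sub_mul_odds_rpow (γ : ℝ) {x : ℝ} (hx : x ∈ Ioo (0 : ℝ) 1) :
    HasDerivAt (fun y : ℝ => (1 - y) * (y / (1 - y)) ^ γ)
      ((x / (1 - x)) ^ γ * ((γ - x) / x)) x := by
  have hx0 : 0 < x := hx.1
  have hx1 : 0 < 1 - x := sub_pos.2 hx.2
  have hsub : HasDerivAt (fun y : ℝ => 1 - y) (-1) x := (hasDerivAt_id x).const_sub 1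
  have hodds := (hasDerivAt_id x).div hsub hx1.ne'
  have hpow := hodds.rpow_const (p := γ) (Or.inl (div_pos hx0 hx1).ne')
  refine (hsub.mul hpow).congr_deriv ?_
  simp only [Pi.div_apply, id, Real.rpow_sub_one (div_pos hx0 hx1).ne']
  field_simp
  ring

/-- Second derivative of the homogeneous solution `x ↦ (1 - x) * (x / (1 - x)) ^ γ`. -/
theorem hasDerivAt_odds_rpow_mul_sub_div (γ : ℝ) {x : ℝ} (hx : x ∈ Ioo (0 : ℝ) 1) :
    HasDerivAt (fun y : ℝ => (y / (1 - y)) ^ γ * ((γ - y) / y))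
      ((x / (1 - x)) ^ γ * (γ * (γ - 1) / (x ^ 2 * (1 - x)))) x := by
  have hx0 : 0 < x := hx.1
  have hx1 : 0 < 1 - x := sub_pos.2 hx.2
  have hsub (a : ℝ) : HasDerivAt (fun y : ℝ => a - y) (-1) x := (hasDerivAt_id x).const_sub a
  have hodds := (hasDerivAt_id x).div (hsub 1) hx1.ne'
  have hpow := hodds.rpow_const (p := γ) (Or.inl (div_pos hx0 hx1).ne')
  refine (hpow.mul ((hsub γ).div (hasDerivAt_id x) hx0.ne')).congr_deriv ?_
  simp only [Pi.div_apply, id, Real.rpow_sub_one (div_pos hx0 hx1).ne']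
  field_simp
  ring

theorem monotoneOn_odds_rpow_mul_sub_div {γ : ℝ} (hγ : 1 < γ) :
    MonotoneOn (fun y : ℝ => (y / (1 - y)) ^ γ * ((γ - y) / y)) (Ioo 0 1) := by
  refine monotoneOn_of_deriv_nonneg (convex_Ioo 0 1)
    (fun x hx => (hasDerivAt_odds_rpow_mul_sub_div γ hx).continuousAt.continuousWithinAt)
    (fun x hx => ?_) (fun x hx => ?_) <;> rw [interior_Ioo] at hx
  · exact (hasDerivAt_odds_rpow_mul_sub_div γ hx).differentiableAt.differentiableWithinAt
  · rw [(hasDerivAt_odds_rpow_mul_sub_div γ hx).deriv]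
    have hx0 : 0 < x := hx.1
    have hx1 : 0 < 1 - x := sub_pos.2 hx.2
    have hγ1 : 0 < γ - 1 := sub_pos.2 hγ
    positivity

/-- Two differentiable functions that agree to first order at `c` glue to a differentiable
function at `c`. -/
theorem HasDerivAt.ite_lt {f g : ℝ → ℝ} {c d : ℝ} (hf : HasDerivAt f d c)
    (hg : HasDerivAt g d c) (hfg : f c = g c) :
    HasDerivAt (fun y => if y < c then f y else g y) d c := by
  have hleft : HasDerivWithinAt (fun y => if y < c then f y else g y) d (Iic c) c := by
    refine hf.hasDerivWithinAt.congr (fun y hy => ?_) (by simp [hfg])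
    rcases (mem_Iic.1 hy).lt_or_eq with h | rfl
    · simp [h]
    · simp [hfg]
  have hright : HasDerivWithinAt (fun y => if y < c then f y else g y) d (Ici c) c :=
    hg.hasDerivWithinAt.congr (fun y hy => by simp [not_lt.2 (mem_Ici.1 hy)]) (by simp)
  simpa [Iic_union_Ici] using hleft.union hright

/-- Properties of the candidate value function of the constant-learning-rate
optimal stopping problem: smooth fit at `c`, convexity, dominance over the
payoff `π − k`, and the variational inequality away from `c`. -/
theorem statement13
    (r ρ k γ : ℝ) (hr : 0 < r) (hρ : 0 < ρ) (hk : k ∈ Ioo (0 : ℝ) 1)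
    (hγ : 1 < γ) (hquad : γ ^ 2 - γ - 2 * r / ρ ^ 2 = 0)
    (c : ℝ) (hc : c = k * γ / (k + γ - 1))
    (G : ℝ → ℝ) (hG : ∀ π : ℝ, G π = (1 - π) * (π / (1 - π)) ^ γ)
    (vhat : ℝ → ℝ)
    (hvhat : ∀ π : ℝ, vhat π = if π < c then (c - k) / G c * G π else π - k) :
    ContDiffOn ℝ 1 vhat (Ioo 0 1) ∧
    ConvexOn ℝ (Ioo 0 1) vhat ∧
    (∀ π ∈ Ioo (0 : ℝ) 1, π - k ≤ vhat π) ∧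
    (∀ π ∈ Ioo (0 : ℝ) 1, π ≠ c →
      ρ ^ 2 / 2 * (π ^ 2 * (1 - π) ^ 2) * deriv (deriv vhat) π - r * vhat π ≤ 0) := by
  obtain ⟨hk0, hk1⟩ := hk
  have hden : 0 < k + γ - 1 := by linarith
  have hkc : k < c := by rw [hc, lt_div_iff₀ hden]; nlinarith
  have hc1 : c < 1 := by rw [hc, div_lt_one hden]; nlinarith
  have hcmem : c ∈ Ioo (0 : ℝ) 1 := ⟨hk0.trans hkc, hc1⟩
  have hceq : c * (k + γ - 1) = k * γ := by rw [hc]; field_simp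
  set G' : ℝ → ℝ := fun y => (y / (1 - y)) ^ γ * ((γ - y) / y) with hG'
  have hGfun : G = fun y : ℝ => (1 - y) * (y / (1 - y)) ^ γ := funext hG
  have hdG {x : ℝ} (hx : x ∈ Ioo (0 : ℝ) 1) : HasDerivAt G (G' x) x :=
    hGfun ▸ hasDerivAt_one_sub_mul_odds_rpow γ hx
  have hGc : 0 < G c := by
    rw [hG]
    have := hcmem.1
    have : 0 < 1 - c := sub_pos.2 hc1
    positivity
  set A : ℝ := (c - k) / G c with hA
  have hApos : 0 < A := div_pos (sub_pos.2 hkc) hGc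
  have hvalue : A * G c = c - k := div_mul_cancel₀ _ hGc.ne'
  have hsmooth : A * G' c = 1 := by
    have hodds : 0 < (c / (1 - c)) ^ γ :=
      Real.rpow_pos_of_pos (div_pos hcmem.1 (sub_pos.2 hc1)) γ
    have h0 : c ≠ 0 := hcmem.1.ne'
    have h1 : 1 - c ≠ 0 := (sub_pos.2 hc1).ne'
    simp only [hA, hG', hG]
    generalize (c / (1 - c)) ^ γ = T at hodds ⊢
    field_simp
    linear_combination hceq
  have hvfun : vhat = fun y => if y < c then A * G y else y - k := funext hvhat
  set w : ℝ → ℝ := fun y => min (A * G' y) 1 with hw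
  have hmono : MonotoneOn (fun y => A * G' y) (Ioo 0 1) := fun x hx y hy hxy =>
    mul_le_mul_of_nonneg_left (monotoneOn_odds_rpow_mul_sub_div hγ hx hy hxy) hApos.le
  have hw_lt {x : ℝ} (hx : x ∈ Ioo (0 : ℝ) 1) (hxc : x ≤ c) : w x = A * G' x :=
    min_eq_left (hsmooth ▸ hmono hx hcmem hxc)
  have hw_ge {x : ℝ} (hx : x ∈ Ioo (0 : ℝ) 1) (hxc : c ≤ x) : w x = 1 :=
    min_eq_right (hsmooth ▸ hmono hcmem hx hxc)
  have hdv {x : ℝ} (hx : x ∈ Ioo (0 : ℝ) 1) : HasDerivAt vhat (w x) x := by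
    rcases lt_trichotomy x c with hxc | rfl | hxc
    · rw [hw_lt hx hxc.le]
      refine ((hdG hx).const_mul A).congr_of_eventuallyEq ?_
      filter_upwards [Iio_mem_nhds hxc] with y hy
      rw [hvhat, if_pos (mem_Iio.1 hy)]
    · rw [hvfun, hw_ge hx le_rfl]
      exact HasDerivAt.ite_lt (hsmooth ▸ (hdG hx).const_mul A)
        ((hasDerivAt_id x).sub_const k) hvalue
    · rw [hw_ge hx hxc.le]
      refine ((hasDerivAt_id x).sub_const k).congr_of_eventuallyEq ?_
      filter_upwards [Ioi_mem_nhds hxc] with y hy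
      rw [hvhat, if_neg (not_lt.2 (le_of_lt hy)), id]
  have hcont : ContinuousOn vhat (Ioo 0 1) := fun x hx =>
    (hdv hx).continuousAt.continuousWithinAt
  have hdiff : DifferentiableOn ℝ vhat (Ioo 0 1) := fun x hx =>
    (hdv hx).differentiableAt.differentiableWithinAt
  have hderiv : EqOn (deriv vhat) w (Ioo 0 1) := fun x hx => (hdv hx).deriv
  refine ⟨?_, ?_, fun x hx => ?_, fun x hx hxc => ?_⟩
  · refine (contDiffOn_succ_iff_deriv_of_isOpen (n := 0) isOpen_Ioo).2
      ⟨hdiff, by simp, contDiffOn_zero.2 (ContinuousOn.congr (fun x hx => ?_) hderiv)⟩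
    have hwx : ContinuousAt w x :=
      ((hasDerivAt_odds_rpow_mul_sub_div γ hx).continuousAt.const_mul A).min continuousAt_const
    exact hwx.continuousWithinAt
  · refine MonotoneOn.convexOn_of_deriv (convex_Ioo 0 1) hcont (by rwa [interior_Ioo]) ?_
    rw [interior_Ioo]
    exact MonotoneOn.congr (fun x hx y hy hxy => min_le_min_right 1 (hmono hx hy hxy))
      hderiv.symm
  · have hanti : AntitoneOn (fun y => vhat y - (y - k)) (Ioo 0 1) := by
      have hd {y : ℝ} (hy : y ∈ Ioo (0 : ℝ) 1) :
          HasDerivAt (fun y => vhat y - (y - k)) (w y - 1) y :=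
        (hdv hy).sub ((hasDerivAt_id y).sub_const k)
      refine antitoneOn_of_deriv_nonpos (convex_Ioo 0 1)
        (fun y hy => (hd hy).continuousAt.continuousWithinAt)
        (fun y hy => ?_) (fun y hy => ?_) <;> rw [interior_Ioo] at hy
      · exact (hd hy).differentiableAt.differentiableWithinAt
      · rw [(hd hy).deriv]
        exact sub_nonpos.2 (min_le_right _ _)
    rcases le_total x c with hxc | hxc
    · have h := hanti hx hcmem hxc
      have hvc : vhat c = c - k := by rw [hvhat, if_neg (lt_irrefl c)]
      simp only [hvc, sub_self] at h
      exact sub_nonneg.1 h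
    · rw [hvhat, if_neg (not_lt.2 hxc)]
  · rcases lt_or_gt_of_ne hxc with hxc | hxc
    · have hd2 : deriv (deriv vhat) x =
          A * ((x / (1 - x)) ^ γ * (γ * (γ - 1) / (x ^ 2 * (1 - x)))) := by
        refine HasDerivAt.deriv (((hasDerivAt_odds_rpow_mul_sub_div γ hx).const_mul
          A).congr_of_eventuallyEq ?_)
        filter_upwards [Iio_mem_nhds hxc, Ioo_mem_nhds hx.1 hx.2] with y hyc hy
        rw [hderiv hy, hw_lt hy (le_of_lt hyc)]
      have hr' : ρ ^ 2 / 2 * (γ * (γ - 1)) = r := by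
        field_simp at hquad
        linarith
      have h0 : x ≠ 0 := hx.1.ne'
      have h1 : 1 - x ≠ 0 := (sub_pos.2 hx.2).ne'
      rw [hd2, hvhat, if_pos hxc, hG, ← hr']
      apply le_of_eq
      field_simp
      ring
    · have hd2 : deriv (deriv vhat) x = 0 := by
        refine HasDerivAt.deriv ((hasDerivAt_const x (1 : ℝ)).congr_of_eventuallyEq ?_)
        filter_upwards [Ioi_mem_nhds hxc, Ioo_mem_nhds hx.1 hx.2] with y hyc hy
        rw [hderiv hy, hw_ge hy (le_of_lt hyc)]
      rw [hd2, hvhat, if_neg (not_lt.2 hxc.le)]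
      have : 0 < x - k := sub_pos.2 (hkc.trans hxc)
      nlinarith
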